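/- Let u ∈ C^∞(ℝⁿ), k ∈ ℕ with k ≥ 1, s > 8, ρ > 0, and let γ ∈ C^∞(ℝⁿ) satisfy χ_{B_ρ(0)} ≤ γ ≤ χ_{B_{2ρ}(0)}, |∇γ| ≤ c_γ/ρ and |∇²γ| ≤ c_γ/ρ², where c_γ ≥ 1 is a constant depending only on n. Then for every δ₀ > 0, ∫_{ℝⁿ} |Δᵏu|² γ^{s-4} dx ≤ δ₀ ρ⁴ ∫_{ℝⁿ} |Δ^{k+1}u|² γˢ dx + (c_{δ₀}/ρ⁴) ∫_{ℝⁿ} |Δ^{k-1}u|² γ^{s-8} dx, where c_{δ₀} = 2⁴(δ₀⁻¹ + 2⁹ s⁴ c_γ⁴). -/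

import Mathlib

open MeasureTheory Metric Set

noncomputable section

/-- The spatial Laplacian of a function `f : ℝⁿ → ℝ`: `Δf(x) = ∑ i, ∂²f/∂xᵢ²(x)`. -/
def Lap {n : ℕ} (f : EuclideanSpace ℝ (Fin n) → ℝ) : EuclideanSpace ℝ (Fin n) → ℝ :=
  fun x => ∑ i : Fin n,
    iteratedFDeriv ℝ 2 f x (fun _ => EuclideanSpace.single i (1 : ℝ))

/-- The `k`-th iterated Laplacian (`iterLap 0 f = f`, `iterLap 2 f = Δ²f`). -/
def iterLap {n : ℕ} (k : ℕ) (f : EuclideanSpace ℝ (Fin n) → ℝ) :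
    EuclideanSpace ℝ (Fin n) → ℝ :=
  Lap^[k] f

/-- Partial derivative of `f` in the `i`-th coordinate direction. -/
def pderiv1 {n : ℕ} (i : Fin n) (f : EuclideanSpace ℝ (Fin n) → ℝ)
    (x : EuclideanSpace ℝ (Fin n)) : ℝ :=
  fderiv ℝ f x (EuclideanSpace.single i (1 : ℝ))

/-- A smooth cutoff function `γ` as in `(γ)`: `χ_{B_ρ(0)} ≤ γ ≤ χ_{B_{2ρ}(0)}`,
`|∇γ| ≤ c_γ/ρ` and `|∇²γ| ≤ c_γ/ρ²`. -/
structure IsCutoff {n : ℕ} (γ : EuclideanSpace ℝ (Fin n) → ℝ) (ρ cγ : ℝ) : Prop where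
  smooth : ContDiff ℝ (⊤ : ℕ∞) γ
  lower : ∀ x, Set.indicator (Metric.ball (0 : EuclideanSpace ℝ (Fin n)) ρ) 1 x ≤ γ x
  upper : ∀ x, γ x ≤ Set.indicator (Metric.ball (0 : EuclideanSpace ℝ (Fin n)) (2 * ρ)) 1 x
  grad : ∀ x, ‖fderiv ℝ γ x‖ ≤ cγ / ρ
  hess : ∀ x, ‖iteratedFDeriv ℝ 2 γ x‖ ≤ cγ / ρ ^ 2

open InnerProductSpace

open scoped Gradient

variable {n : ℕ}

lemma Lap_eq_sum_fderiv {f : EuclideanSpace ℝ (Fin n) → ℝ} (hf : ContDiff ℝ (⊤ : ℕ∞) f)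
    (x : EuclideanSpace ℝ (Fin n)) :
    Lap f x = ∑ i : Fin n, fderiv ℝ (pderiv1 i f) x (EuclideanSpace.single i (1 : ℝ)) := by
  unfold Lap
  refine Finset.sum_congr rfl fun i _ => ?_
  have hd : DifferentiableAt ℝ (fderiv ℝ f) x :=
    (hf.fderiv_right (m := (⊤ : ℕ∞)) (by simp)).differentiable (by simp) x
  have h : HasFDerivAt (pderiv1 i f) _ x :=
    hd.hasFDerivAt.clm_apply (hasFDerivAt_const (EuclideanSpace.single i (1 : ℝ)) x)
  rw [iteratedFDeriv_two_apply, h.fderiv]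
  simp

lemma contDiff_pderiv1 {f : EuclideanSpace ℝ (Fin n) → ℝ} (hf : ContDiff ℝ (⊤ : ℕ∞) f)
    (i : Fin n) : ContDiff ℝ (⊤ : ℕ∞) (pderiv1 i f) :=
  (hf.fderiv_right (m := (⊤ : ℕ∞)) (by simp)).clm_apply contDiff_const

lemma contDiff_Lap {f : EuclideanSpace ℝ (Fin n) → ℝ} (hf : ContDiff ℝ (⊤ : ℕ∞) f) :
    ContDiff ℝ (⊤ : ℕ∞) (Lap f) := by
  rw [funext (Lap_eq_sum_fderiv hf)]
  exact ContDiff.sum fun i _ => contDiff_pderiv1 (contDiff_pderiv1 hf i) i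

lemma contDiff_iterLap {f : EuclideanSpace ℝ (Fin n) → ℝ} (hf : ContDiff ℝ (⊤ : ℕ∞) f) (k : ℕ) :
    ContDiff ℝ (⊤ : ℕ∞) (iterLap k f) := by
  induction k with
  | zero => exact hf
  | succ k ih =>
    simp only [iterLap, Function.iterate_succ_apply'] at ih ⊢
    exact contDiff_Lap ih

lemma continuous_gradient {f : EuclideanSpace ℝ (Fin n) → ℝ} (hf : ContDiff ℝ (⊤ : ℕ∞) f) :
    Continuous (∇ f) :=
  (toDual ℝ (EuclideanSpace ℝ (Fin n))).symm.continuous.comp (hf.continuous_fderiv (by simp))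

lemma inner_gradient_eq_sum (f g : EuclideanSpace ℝ (Fin n) → ℝ)
    (x : EuclideanSpace ℝ (Fin n)) :
    inner ℝ (∇ f x) (∇ g x) = ∑ i : Fin n, pderiv1 i f x * pderiv1 i g x := by
  have h (f : EuclideanSpace ℝ (Fin n) → ℝ) (i : Fin n) :
      inner ℝ (∇ f x) (EuclideanSpace.basisFun (Fin n) ℝ i) = pderiv1 i f x := by
    rw [← toDual_apply_apply, toDual_gradient, EuclideanSpace.basisFun_apply, pderiv1]
  rw [← (EuclideanSpace.basisFun (Fin n) ℝ).sum_inner_mul_inner]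
  refine Finset.sum_congr rfl fun i _ => ?_
  rw [h, real_inner_comm, h]

namespace IsCutoff

variable {γ : EuclideanSpace ℝ (Fin n) → ℝ} {ρ cγ : ℝ}

lemma nonneg (hγ : IsCutoff γ ρ cγ) (x : EuclideanSpace ℝ (Fin n)) : 0 ≤ γ x :=
  (Set.indicator_nonneg (fun _ _ => zero_le_one) x).trans (hγ.lower x)

lemma norm_gradient_le (hγ : IsCutoff γ ρ cγ) (x : EuclideanSpace ℝ (Fin n)) :
    ‖∇ γ x‖ ≤ cγ / ρ := by
  rw [gradient, LinearIsometryEquiv.norm_map]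
  exact hγ.grad x

lemma continuous_rpow (hγ : IsCutoff γ ρ cγ) {b : ℝ} (hb : 0 < b) :
    Continuous fun x => γ x ^ b :=
  hγ.smooth.continuous.rpow_const fun _ => Or.inr hb.le

lemma hasCompactSupport_rpow (hγ : IsCutoff γ ρ cγ) {b : ℝ} (hb : 0 < b) :
    HasCompactSupport fun x => γ x ^ b := by
  refine HasCompactSupport.intro (isCompact_closedBall 0 (2 * ρ)) fun x hx => ?_
  have hx' : x ∉ Metric.ball (0 : EuclideanSpace ℝ (Fin n)) (2 * ρ) :=
    fun h => hx (Metric.ball_subset_closedBall h)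
  have h := hγ.upper x
  rw [Set.indicator_of_notMem hx'] at h
  rw [le_antisymm h (hγ.nonneg x), Real.zero_rpow hb.ne']

lemma integrable_mul_rpow (hγ : IsCutoff γ ρ cγ) {b : ℝ} (hb : 0 < b)
    {h : EuclideanSpace ℝ (Fin n) → ℝ} (hh : Continuous h) :
    Integrable fun x => h x * γ x ^ b :=
  (hh.mul (hγ.continuous_rpow hb)).integrable_of_hasCompactSupport
    (hγ.hasCompactSupport_rpow hb).mul_left

end IsCutoff

/-- The divergence of the vector field `f γᵇ ∇g`, in expanded form. -/
def weightedDiv (γ f g : EuclideanSpace ℝ (Fin n) → ℝ) (b : ℝ)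
    (x : EuclideanSpace ℝ (Fin n)) : ℝ :=
  (f x * Lap g x + inner ℝ (∇ f x) (∇ g x)) * γ x ^ b
    + b * f x * inner ℝ (∇ g x) (∇ γ x) * γ x ^ (b - 1)

section weightedDiv

variable {γ f g : EuclideanSpace ℝ (Fin n) → ℝ} {ρ cγ b : ℝ}

lemma integrable_weightedDiv (hγ : IsCutoff γ ρ cγ) (hf : ContDiff ℝ (⊤ : ℕ∞) f)
    (hg : ContDiff ℝ (⊤ : ℕ∞) g) (hb : 1 < b) : Integrable (weightedDiv γ f g b) := by
  have h1 := hf.continuous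
  have h2 := (contDiff_Lap hg).continuous
  have h3 := continuous_gradient hf
  have h4 := continuous_gradient hg
  have h5 := continuous_gradient hγ.smooth
  exact (hγ.integrable_mul_rpow (by linarith) (by fun_prop)).add
    (hγ.integrable_mul_rpow (by linarith) (by fun_prop))

lemma integral_weightedDiv (hγ : IsCutoff γ ρ cγ) (hf : ContDiff ℝ (⊤ : ℕ∞) f)
    (hg : ContDiff ℝ (⊤ : ℕ∞) g) (hb : 1 < b) : ∫ x, weightedDiv γ f g b x = 0 := by
  set F : Fin n → EuclideanSpace ℝ (Fin n) → ℝ :=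
    fun i x => f x * pderiv1 i g x * γ x ^ b with hF
  set F' : Fin n → EuclideanSpace ℝ (Fin n) → ℝ := fun i x =>
    (f x * fderiv ℝ (pderiv1 i g) x (EuclideanSpace.single i 1)
      + pderiv1 i f x * pderiv1 i g x) * γ x ^ b
      + (b * f x * (pderiv1 i g x * pderiv1 i γ x)) * γ x ^ (b - 1) with hF'
  have hdiff (i : Fin n) (x) : ∃ A : EuclideanSpace ℝ (Fin n) →L[ℝ] ℝ,
      HasFDerivAt (F i) A x ∧
      A (EuclideanSpace.single i 1) = F' i x := by
    have h1 := (hf.differentiable (by simp) x).hasFDerivAt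
    have h2 := ((contDiff_pderiv1 hg i).differentiable (by simp) x).hasFDerivAt
    have h3 := (hγ.smooth.differentiable (by simp) x).hasFDerivAt.rpow_const
      (p := b) (Or.inr hb.le)
    refine ⟨_, (h1.mul h2).mul h3, ?_⟩
    simp [hF', pderiv1]
    ring
  have hfderiv (i : Fin n) (x) :
      fderiv ℝ (F i) x (EuclideanSpace.single i 1) = F' i x := by
    obtain ⟨A, hA, h⟩ := hdiff i x
    rw [hA.fderiv, h]
  have hint (i : Fin n) : Integrable (F i) :=
    hγ.integrable_mul_rpow (by linarith) (hf.continuous.mul (contDiff_pderiv1 hg i).continuous)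
  have hint' (i : Fin n) : Integrable (F' i) := by
    have h1 := hf.continuous
    have h2 := (contDiff_pderiv1 (contDiff_pderiv1 hg i) i).continuous
    have h3 := (contDiff_pderiv1 hf i).continuous
    have h4 := (contDiff_pderiv1 hg i).continuous
    have h5 := (contDiff_pderiv1 hγ.smooth i).continuous
    exact (hγ.integrable_mul_rpow (by linarith) ((h1.mul h2).add (h3.mul h4))).add
      (hγ.integrable_mul_rpow (by linarith) ((continuous_const.mul h1).mul (h4.mul h5)))
  have hzero (i : Fin n) : ∫ x, F' i x = 0 := by
    have h := integral_mul_fderiv_eq_neg_fderiv_mul_of_integrable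
      (μ := (volume : Measure (EuclideanSpace ℝ (Fin n)))) (f := fun _ => (1 : ℝ)) (g := F i)
      (v := EuclideanSpace.single i (1 : ℝ)) (by simp)
      (by simpa [hfderiv] using hint' i)
      (by simpa using hint i)
      (fun x _ => by fun_prop) (fun x _ => (hdiff i x).choose_spec.1.differentiableAt)
    simpa [hfderiv] using h
  have hsum : weightedDiv γ f g b = fun x => ∑ i, F' i x := by
    funext x
    simp only [weightedDiv, hF', Lap_eq_sum_fderiv hg, inner_gradient_eq_sum,
      Finset.sum_add_distrib, ← Finset.sum_mul, ← Finset.mul_sum]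
  rw [hsum, integral_finsetSum _ fun i _ => hint' i, Finset.sum_eq_zero fun i _ => hzero i]

end weightedDiv

/-- Absorption by Young's inequality, with `α` a weight interpolating between `√D` and `L⁻²`. -/
lemma exists_young_absorption {D L : ℝ} (hD : 0 < D) (hL : 0 < L) :
    ∃ α : ℝ, ∀ v x Y q r m₁ m₂ m₃ m₄ : ℝ, |m₁| ≤ L * q → |m₂| ≤ L * r → |m₃| ≤ L * q →
      |m₄| ≤ L * r →
      v * Y + v * m₁ - x * m₂ ≤ x ^ 2 / 2 + D / 2 * Y ^ 2 + (8 / D + 4096 * L ^ 4) * v ^ 2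
        + 2 * α * (x * Y + q ^ 2 + x * m₃) + 4 * L ^ 2 * (v * x + r ^ 2 + v * m₄) := by
  obtain ⟨d, hd, rfl⟩ : ∃ d : ℝ, 0 < d ∧ d ^ 2 = D :=
    ⟨√D, Real.sqrt_pos.2 hD, Real.sq_sqrt hD.le⟩
  set e := d⁻¹ with he
  have he0 : 0 < e := inv_pos.2 hd
  have hde : d * e = 1 := mul_inv_cancel₀ hd.ne'
  set B := 8 * e + 8 * L ^ 2 with hB
  have hB0 : 0 < B := by positivity
  set α := B⁻¹ with hα
  have hα0 : 0 < α := inv_pos.2 hB0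
  have hαB : α * B = 1 := inv_mul_cancel₀ hB0.ne'
  have hαL : α * L ^ 2 ≤ 1 / 8 := by nlinarith [mul_pos hα0 he0]
  have hαe : α * e ≤ 1 / 8 := by nlinarith [mul_pos hα0 (pow_pos hL 2)]
  have hαd : α ≤ d / 8 := by
    calc α = α * e * d := by rw [mul_assoc, mul_comm e, hde, mul_one]
      _ ≤ 1 / 8 * d := by gcongr
      _ = d / 8 := by ring
  have hα2 : 8 * α ^ 2 ≤ d ^ 2 / 8 := by nlinarith
  have hLB : L ^ 2 * B / 4 ≤ e ^ 2 + 3 * L ^ 4 := by nlinarith [sq_nonneg (e - L ^ 2)]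
  have hDe : 8 / d ^ 2 = 8 * e ^ 2 := by rw [he]; field_simp
  refine ⟨α, fun v x Y q r m₁ m₂ m₃ m₄ h₁ h₂ h₃ h₄ => ?_⟩
  rw [hDe]
  have hsq {a b : ℝ} (h : |a| ≤ L * b) : a ^ 2 ≤ L ^ 2 * b ^ 2 := by
    rw [← mul_pow]; exact sq_le_sq' (abs_le.1 h).1 (abs_le.1 h).2
  have e1 : v * Y ≤ d ^ 2 / 4 * Y ^ 2 + e ^ 2 * v ^ 2 := by
    have h : v * Y = (d * Y) * (e * v) := by linear_combination (-(v * Y)) * hde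
    rw [h]; nlinarith [sq_nonneg (d * Y / 2 - e * v)]
  have e2 : v * m₁ ≤ α * q ^ 2 + (e ^ 2 + 3 * L ^ 4) * v ^ 2 := by
    have h : v * m₁ ≤ L ^ 2 * B / 4 * v ^ 2 + α * q ^ 2 := by
      have h1 : |v * m₁| ≤ |v| * (L * q) := by rw [abs_mul]; gcongr
      have h2 : |v| * (L * q) = α * B * (|v| * (L * q)) := by rw [hαB, one_mul]
      have h3 : L ^ 2 * B / 4 * v ^ 2 = α * (L * B * |v| / 2) ^ 2 := by
        rw [div_pow, mul_pow, mul_pow, sq_abs]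
        linear_combination (-(L ^ 2 * B * v ^ 2 / 4)) * hαB
      nlinarith [le_abs_self (v * m₁), mul_nonneg hα0.le (sq_nonneg (L * B * |v| / 2 - q))]
    nlinarith [mul_le_mul_of_nonneg_right hLB (sq_nonneg v)]
  have e3 : -(x * m₂) ≤ x ^ 2 / 8 + 2 * L ^ 2 * r ^ 2 := by
    linear_combination 2 * hsq h₂ + (sq_nonneg (x + 4 * m₂)) / 8
  have e4 : q ^ 2 ≤ 2 * (x * Y + q ^ 2 + x * m₃) - 2 * (x * Y) + L ^ 2 * x ^ 2 := by
    have h1 : |x * m₃| ≤ |x| * (L * q) := by rw [abs_mul]; gcongr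
    have h2 : (L * |x| - q) ^ 2 = L ^ 2 * x ^ 2 - 2 * (|x| * (L * q)) + q ^ 2 := by
      rw [← sq_abs x]; ring
    linarith [neg_abs_le (x * m₃), sq_nonneg (L * |x| - q)]
  have e5 : r ^ 2 ≤ 2 * (v * x + r ^ 2 + v * m₄) - 2 * (v * x) + L ^ 2 * v ^ 2 := by
    have h1 : |v * m₄| ≤ |v| * (L * r) := by rw [abs_mul]; gcongr
    have h2 : (L * |v| - r) ^ 2 = L ^ 2 * v ^ 2 - 2 * (|v| * (L * r)) + r ^ 2 := by
      rw [← sq_abs v]; ring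
    linarith [neg_abs_le (v * m₄), sq_nonneg (L * |v| - r)]
  have e6 : -(2 * α * (x * Y)) ≤ x ^ 2 / 8 + d ^ 2 / 8 * Y ^ 2 := by
    linear_combination (sq_nonneg (x + 8 * α * Y)) / 8
      + mul_le_mul_of_nonneg_right hα2 (sq_nonneg Y)
  have e7 : α * L ^ 2 * x ^ 2 ≤ x ^ 2 / 8 := by
    linear_combination mul_le_mul_of_nonneg_right hαL (sq_nonneg x)
  have e8 : -(4 * L ^ 2 * (v * x)) ≤ x ^ 2 / 8 + 32 * L ^ 4 * v ^ 2 := by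
    linear_combination (sq_nonneg (x + 16 * L ^ 2 * v)) / 8
  have e9 := mul_le_mul_of_nonneg_left e4 hα0.le
  have e10 := mul_le_mul_of_nonneg_left e5 (by positivity : 0 ≤ 2 * L ^ 2)
  have p1 : 0 ≤ d ^ 2 * Y ^ 2 := by positivity
  have p2 : 0 ≤ e ^ 2 * v ^ 2 := by positivity
  have p3 : 0 ≤ L ^ 4 * v ^ 2 := by positivity
  linarith

/-- **Lemma A.2 (interpolation inequality with explicit constant).** For `u ∈ C^∞(ℝⁿ)`,
`k ≥ 1`, `s > 8`, `γ` a cutoff as in `(γ)` and any `δ₀ > 0`,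
`∫|Δᵏu|²γ^{s-4} ≤ δ₀ρ⁴∫|Δ^{k+1}u|²γˢ + (c_{δ₀}/ρ⁴)∫|Δ^{k-1}u|²γ^{s-8}` where
`c_{δ₀} = 2⁴(δ₀⁻¹ + 2⁹s⁴c_γ⁴)`. -/
theorem interpolation_estimate (n : ℕ) (u γ : EuclideanSpace ℝ (Fin n) → ℝ)
    (hu : ContDiff ℝ (⊤ : ℕ∞) u) (k : ℕ) (hk : 1 ≤ k) (s ρ cγ : ℝ)
    (hs : 8 < s) (hρ : 0 < ρ) (hcγ : 1 ≤ cγ) (hγ : IsCutoff γ ρ cγ)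
    (δ₀ : ℝ) (hδ₀ : 0 < δ₀) :
    (∫ x, (iterLap k u x) ^ 2 * γ x ^ (s - 4))
      ≤ δ₀ * ρ ^ 4 * (∫ x, (iterLap (k + 1) u x) ^ 2 * γ x ^ s)
        + (2 ^ 4 * (δ₀⁻¹ + 2 ^ 9 * s ^ 4 * cγ ^ 4)) / ρ ^ 4
          * (∫ x, (iterLap (k - 1) u x) ^ 2 * γ x ^ (s - 8)) := by
  set v := iterLap (k - 1) u with hv
  have hw : iterLap k u = Lap v := by
    obtain ⟨j, rfl⟩ : ∃ j, k = j + 1 := ⟨k - 1, by omega⟩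
    simp [hv, iterLap, Function.iterate_succ_apply']
  have hW : iterLap (k + 1) u = Lap (Lap v) := by
    rw [← hw]; simp [iterLap, Function.iterate_succ_apply']
  have hvs : ContDiff ℝ (⊤ : ℕ∞) v := contDiff_iterLap hu _
  rw [hw, hW]
  set w := Lap v with hw_def
  have hws : ContDiff ℝ (⊤ : ℕ∞) w := contDiff_Lap hvs
  have hWs : ContDiff ℝ (⊤ : ℕ∞) (Lap w) := contDiff_Lap hws
  set M := cγ / ρ with hM
  have hM0 : 0 < M := by positivity
  set L := s * M with hL
  have hL0 : 0 < L := mul_pos (by linarith) hM0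
  set D := δ₀ * ρ ^ 4 with hD
  obtain ⟨α, hα⟩ := exists_young_absorption (D := D) (L := L) (by positivity) hL0
  have hC : 2 ^ 4 * (δ₀⁻¹ + 2 ^ 9 * s ^ 4 * cγ ^ 4) / ρ ^ 4
      = 2 * (8 / D + 4096 * L ^ 4) := by
    rw [hD, hL, hM]; field_simp; ring
  rw [hC]
  have key (x : EuclideanSpace ℝ (Fin n)) :
      w x ^ 2 * γ x ^ (s - 4) ≤ D * (Lap w x ^ 2 * γ x ^ s)
        + 2 * (8 / D + 4096 * L ^ 4) * (v x ^ 2 * γ x ^ (s - 8))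
        + (2 * weightedDiv γ w v (s - 4) x - 2 * weightedDiv γ v w (s - 4) x
          + 4 * α * weightedDiv γ w w (s - 2) x + 8 * L ^ 2 * weightedDiv γ v v (s - 6) x) := by
    have hpow (j : ℕ) (b : ℝ) (hb : b = s - 8 + j) : γ x ^ b = γ x ^ (s - 8) * γ x ^ j := by
      rw [hb, Real.rpow_add_natCast' (hγ.nonneg x)]
      have : (0 : ℝ) ≤ j := j.cast_nonneg
      linarith
    have hp : 0 ≤ γ x ^ (s - 8) := Real.rpow_nonneg (hγ.nonneg x) _
    have hbound (P : EuclideanSpace ℝ (Fin n)) (b : ℝ) (hb0 : 0 ≤ b) (hb : b ≤ s) (j : ℕ) :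
        |b * inner ℝ P (∇ γ x) * γ x ^ j| ≤ L * (‖P‖ * γ x ^ j) := by
      have ht : 0 ≤ γ x ^ j := pow_nonneg (hγ.nonneg x) j
      rw [abs_mul, abs_mul, abs_of_nonneg hb0, abs_of_nonneg ht]
      calc b * |inner ℝ P (∇ γ x)| * γ x ^ j ≤ s * (‖P‖ * M) * γ x ^ j := by
            gcongr
            exact (abs_real_inner_le_norm _ _).trans (by gcongr; exact hγ.norm_gradient_le x)
        _ = L * (‖P‖ * γ x ^ j) := by rw [hL]; ring
    have h := mul_le_mul_of_nonneg_left (hα (v x) (w x * γ x ^ 2) (Lap w x * γ x ^ 4)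
      (‖∇ w x‖ * γ x ^ 3) (‖∇ v x‖ * γ x ^ 1) _ _ _ _
      (hbound (∇ w x) (s - 4) (by linarith) (by linarith) 3)
      (hbound (∇ v x) (s - 4) (by linarith) (by linarith) 1)
      (hbound (∇ w x) (s - 2) (by linarith) (by linarith) 3)
      (hbound (∇ v x) (s - 6) (by linarith) (by linarith) 1)) hp
    simp only [weightedDiv, ← hw_def, real_inner_self_eq_norm_sq,
      real_inner_comm (∇ v x) (∇ w x)]
    rw [hpow 4 (s - 4) (by push_cast; ring), hpow 8 s (by push_cast; ring),
      hpow 6 (s - 2) (by push_cast; ring), hpow 2 (s - 6) (by push_cast; ring),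
      hpow 3 (s - 4 - 1) (by push_cast; ring), hpow 5 (s - 2 - 1) (by push_cast; ring),
      hpow 1 (s - 6 - 1) (by push_cast; ring)]
    linear_combination 2 * h
  have iI := hγ.integrable_mul_rpow (b := s - 4) (by linarith) (hws.continuous.pow 2)
  have iJ := (hγ.integrable_mul_rpow (b := s) (by linarith) (hWs.continuous.pow 2)).const_mul D
  have iK := (hγ.integrable_mul_rpow (b := s - 8) (by linarith)
    (hvs.continuous.pow 2)).const_mul (2 * (8 / D + 4096 * L ^ 4))
  have i1 := (integrable_weightedDiv hγ hws hvs (b := s - 4) (by linarith)).const_mul 2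
  have i2 := (integrable_weightedDiv hγ hvs hws (b := s - 4) (by linarith)).const_mul 2
  have i3 := (integrable_weightedDiv hγ hws hws (b := s - 2) (by linarith)).const_mul (4 * α)
  have i4 := (integrable_weightedDiv hγ hvs hvs (b := s - 6) (by linarith)).const_mul (8 * L ^ 2)
  refine (integral_mono iI ((iJ.add iK).add (((i1.sub i2).add i3).add i4)) key).trans_eq ?_
  rw [integral_add' (iJ.add iK) (((i1.sub i2).add i3).add i4), integral_add' iJ iK,
    integral_add' ((i1.sub i2).add i3) i4, integral_add' (i1.sub i2) i3, integral_sub' i1 i2]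
  simp only [integral_const_mul, Pi.pow_apply]
  rw [integral_weightedDiv hγ hws hvs (by linarith), integral_weightedDiv hγ hvs hws (by linarith),
    integral_weightedDiv hγ hws hws (by linarith), integral_weightedDiv hγ hvs hvs (by linarith)]
  ring
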